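/- There is no (6,4) net. That is, there do not exist a 36-element point set P and a family of 6-element subsets of P (lines) partitioned into 4 parallel classes, each parallel class partitioning P into 6 lines, such that any two lines from different parallel classes meet in exactly one point. (This is Euler's 36 officers conjecture in net form.) -/

import Mathlib

/-- A `(6,4)` net on a point type `P`: 36 points, lines of size 6 indexed by
4 parallel classes of 6 lines each; each parallel class partitions the point set,
and two lines from different parallel classes meet in exactly one point. -/
structure Net64 (P : Type) [Fintype P] [DecidableEq P] where
  line : Fin 4 → Fin 6 → Finset P
  card_points : Fintype.card P = 36
  line_card : ∀ i j, (line i j).card = 6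
  partition : ∀ (i : Fin 4) (p : P), ∃! j : Fin 6, p ∈ line i j
  meet : ∀ (i i' : Fin 4) (j j' : Fin 6), i ≠ i' → (line i j ∩ line i' j').card = 1

namespace OfficerProof

set_option maxRecDepth 100000 in
set_option synthInstance.maxHeartbeats 0 in
set_option synthInstance.maxSize 100000 in
set_option maxHeartbeats 0 in
/-- The finite search: an incomplete `4 × 4` square with empty diagonal, without transversal mate. -/
theorem fin_search :
  ∀ a01 : Fin 4, a01 ≠ 0 →
  ∀ a02 : Fin 4, a02 ≠ 0 ∧ a02 ≠ a01 →
  ∀ a03 : Fin 4, a03 ≠ 0 ∧ a03 ≠ a01 ∧ a03 ≠ a02 →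
  ∀ a10 : Fin 4, a10 ≠ 1 →
  ∀ a12 : Fin 4, a12 ≠ 1 ∧ a12 ≠ a10 ∧ a12 ≠ a02 →
  ∀ a13 : Fin 4, a13 ≠ 1 ∧ a13 ≠ a10 ∧ a13 ≠ a12 ∧ a13 ≠ a03 →
  ∀ a20 : Fin 4, a20 ≠ 2 ∧ a20 ≠ a10 →
  ∀ a21 : Fin 4, a21 ≠ 2 ∧ a21 ≠ a20 ∧ a21 ≠ a01 →
  ∀ a23 : Fin 4, a23 ≠ 2 ∧ a23 ≠ a20 ∧ a23 ≠ a21 ∧ a23 ≠ a03 ∧ a23 ≠ a13 →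
  ∀ a30 : Fin 4, a30 ≠ 3 ∧ a30 ≠ a10 ∧ a30 ≠ a20 →
  ∀ a31 : Fin 4, a31 ≠ 3 ∧ a31 ≠ a30 ∧ a31 ≠ a01 ∧ a31 ≠ a21 →
  ∀ a32 : Fin 4, a32 ≠ 3 ∧ a32 ≠ a30 ∧ a32 ≠ a31 ∧ a32 ≠ a02 ∧ a32 ≠ a12 →
  (a10 = 0 ∨ a20 = 0 ∨ a30 = 0) ∧ (a01 = 1 ∨ a21 = 1 ∨ a31 = 1) ∧
  (a02 = 2 ∨ a12 = 2 ∨ a32 = 2) ∧ (a03 = 3 ∨ a13 = 3 ∨ a23 = 3) →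
  ∀ b01 : Fin 4, b01 ≠ 0 →
  ∀ b02 : Fin 4, b02 ≠ 0 ∧ b02 ≠ b01 →
  ∀ b03 : Fin 4, b03 ≠ 0 ∧ b03 ≠ b01 ∧ b03 ≠ b02 →
  ∀ b10 : Fin 4, b10 ≠ 1 ∧ (a10, b10) ∉ [(a01, b01), (a02, b02), (a03, b03)] →
  ∀ b12 : Fin 4, b12 ≠ 1 ∧ b12 ≠ b10 ∧ b12 ≠ b02 ∧ (a12, b12) ∉ [(a01, b01), (a02, b02), (a03, b03)] →
  ∀ b13 : Fin 4, b13 ≠ 1 ∧ b13 ≠ b10 ∧ b13 ≠ b12 ∧ b13 ≠ b03 ∧ (a13, b13) ∉ [(a01, b01), (a02, b02), (a03, b03)] →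
  ∀ b20 : Fin 4, b20 ≠ 2 ∧ b20 ≠ b10 ∧ (a20, b20) ∉ [(a01, b01), (a02, b02), (a03, b03), (a10, b10), (a12, b12), (a13, b13)] →
  ∀ b21 : Fin 4, b21 ≠ 2 ∧ b21 ≠ b20 ∧ b21 ≠ b01 ∧ (a21, b21) ∉ [(a01, b01), (a02, b02), (a03, b03), (a10, b10), (a12, b12), (a13, b13)] →
  ∀ b23 : Fin 4, b23 ≠ 2 ∧ b23 ≠ b20 ∧ b23 ≠ b21 ∧ b23 ≠ b03 ∧ b23 ≠ b13 ∧ (a23, b23) ∉ [(a01, b01), (a02, b02), (a03, b03), (a10, b10), (a12, b12), (a13, b13)] →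
  ∀ b30 : Fin 4, b30 ≠ 3 ∧ b30 ≠ b10 ∧ b30 ≠ b20 ∧ (a30, b30) ∉ [(a01, b01), (a02, b02), (a03, b03), (a10, b10), (a12, b12), (a13, b13), (a20, b20), (a21, b21), (a23, b23)] →
  ∀ b31 : Fin 4, b31 ≠ 3 ∧ b31 ≠ b30 ∧ b31 ≠ b01 ∧ b31 ≠ b21 ∧ (a31, b31) ∉ [(a01, b01), (a02, b02), (a03, b03), (a10, b10), (a12, b12), (a13, b13), (a20, b20), (a21, b21), (a23, b23)] →
  ∀ b32 : Fin 4, ¬ (b32 ≠ 3 ∧ b32 ≠ b30 ∧ b32 ≠ b31 ∧ b32 ≠ b02 ∧ b32 ≠ b12 ∧ (a32, b32) ∉ [(a01, b01), (a02, b02), (a03, b03), (a10, b10), (a12, b12), (a13, b13), (a20, b20), (a21, b21), (a23, b23)]) := by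
  decide +kernel


theorem fin_search' (σ τ : Fin 4 → Fin 4 → Fin 4)
    (h1 : ∀ x y, x ≠ y → σ x y ≠ x) (h2 : ∀ x y, x ≠ y → τ x y ≠ x)
    (r1 : ∀ x y z, x ≠ y → x ≠ z → y ≠ z → σ x y ≠ σ x z)
    (r2 : ∀ x y z, x ≠ y → x ≠ z → y ≠ z → τ x y ≠ τ x z)
    (c1 : ∀ x y z, x ≠ z → y ≠ z → x ≠ y → σ x z ≠ σ y z)
    (c2 : ∀ x y z, x ≠ z → y ≠ z → x ≠ y → τ x z ≠ τ y z)
    (o : ∀ x y x' y', x ≠ y → x' ≠ y' → x ≠ x' → (σ x y, τ x y) ≠ (σ x' y', τ x' y'))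
    (d : ∀ y, ∃ x, x ≠ y ∧ σ x y = y) : False := by
  have d0 := d 0
  have d1 := d 1
  have d2 := d 2
  have d3 := d 3
  simp only [Fin.exists_fin_succ, ne_eq] at d0 d1 d2 d3
  simp at d0 d1 d2 d3
  refine fin_search (σ 0 1) ?_ (σ 0 2) ?_ (σ 0 3) ?_ (σ 1 0) ?_ (σ 1 2) ?_ (σ 1 3) ?_
    (σ 2 0) ?_ (σ 2 1) ?_ (σ 2 3) ?_ (σ 3 0) ?_ (σ 3 1) ?_ (σ 3 2) ?_ ⟨?_, ?_, ?_, ?_⟩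
    (τ 0 1) ?_ (τ 0 2) ?_ (τ 0 3) ?_ (τ 1 0) ?_ (τ 1 2) ?_ (τ 1 3) ?_
    (τ 2 0) ?_ (τ 2 1) ?_ (τ 2 3) ?_ (τ 3 0) ?_ (τ 3 1) ?_ (τ 3 2) ?_
  all_goals first
    | assumption
    | (try simp only [List.mem_cons, List.not_mem_nil, or_false, not_or]
       repeat' apply And.intro
       all_goals first
         | (apply h1; decide)
         | (apply h2; decide)
         | (apply r1 <;> decide)
         | (apply r2 <;> decide)
         | (apply c1 <;> decide)
         | (apply c2 <;> decide)
         | (apply o <;> decide))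

theorem sylvester {V W U : Type*} [AddCommGroup V] [AddCommGroup W] [AddCommGroup U]
    [Module (ZMod 2) V] [Module (ZMod 2) W] [Module (ZMod 2) U] [FiniteDimensional (ZMod 2) W]
    (φ : V →ₗ[ZMod 2] W) (ψ : W →ₗ[ZMod 2] U) :
    Module.finrank (ZMod 2) (LinearMap.range φ) ≤
      Module.finrank (ZMod 2) (LinearMap.range (ψ.comp φ)) +
      Module.finrank (ZMod 2) (LinearMap.ker ψ) := by
  have h := LinearMap.finrank_range_add_finrank_ker (ψ.domRestrict (LinearMap.range φ))
  have h1 : LinearMap.range (ψ.domRestrict (LinearMap.range φ)) = LinearMap.range (ψ.comp φ) := by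
    ext x; simp
  rw [h1] at h
  rw [← h]
  gcongr
  refine LinearMap.finrank_le_finrank_of_injective
    (f := ((LinearMap.range φ).subtype.comp
      (LinearMap.ker (ψ.domRestrict (LinearMap.range φ))).subtype).codRestrict (LinearMap.ker ψ) ?_) ?_
  · rintro ⟨x, hx⟩
    simpa using hx
  · intro x y hxy
    have := congrArg Subtype.val hxy
    simp at this
    exact this

/-- every pair of coordinate maps is a bijection with the `6 × 6` grid -/
def PairBij {P : Type} (f : Fin 4 → P → Fin 6) : Prop :=
  ∀ i j, i ≠ j → Function.Bijective (fun p => (f i p, f j p))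

theorem sum_pair {P : Type} [Fintype P] {f : Fin 4 → P → Fin 6} (hf : PairBij f)
    {R : Type*} [AddCommMonoid R]
    {i j : Fin 4} (hij : i ≠ j) (F : Fin 6 → Fin 6 → R) :
    ∑ p, F (f i p) (f j p) = ∑ a, ∑ b, F a b := by
  rw [← Fintype.sum_prod_type']
  exact (Equiv.ofBijective _ (hf i j hij)).sum_comp (fun q : Fin 6 × Fin 6 => F q.1 q.2)

theorem exists_relation {P : Type} [Fintype P] (f : Fin 4 → P → Fin 6) (hf : PairBij f) :
    ∃ c : Fin 4 → Fin 6 → ZMod 2, (∀ p, ∑ i, c i (f i p) = 0) ∧ ¬ ∃ d : Fin 4 → ZMod 2, ∀ i a, c i a = d i := by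
  classical
  have hcard : Fintype.card P = 36 := by
    have := Fintype.card_congr (Equiv.ofBijective _ (hf 0 1 (by decide)))
    simpa using this
  obtain ⟨M, hM⟩ : ∃ M : Matrix P (Fin 4 × Fin 6) (ZMod 2),
      ∀ p i a, M p (i, a) = if f i p = a then 1 else 0 :=
    ⟨Matrix.of fun p q => if f q.1 p = q.2 then 1 else 0, fun _ _ _ => rfl⟩
  obtain ⟨A, hA⟩ : ∃ A : Matrix (Fin 4 × Fin 6) (Fin 4) (ZMod 2),
      ∀ i a j, A (i, a) j = if i = j then 0 else 1 :=
    ⟨Matrix.of fun q j => if q.1 = j then 0 else 1, fun _ _ _ => rfl⟩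
  obtain ⟨B, hB⟩ : ∃ B : Matrix (Fin 4 × Fin 6) (Fin 4) (ZMod 2),
      ∀ i a j, B (i, a) j = if i = j then 1 else 0 :=
    ⟨Matrix.of fun q j => if q.1 = j then 1 else 0, fun _ _ _ => rfl⟩
  have hMM : M.transpose * M = A * B.transpose := by
    ext ⟨i, a⟩ ⟨j, b⟩
    simp only [Matrix.mul_apply, Matrix.transpose_apply, hM, hA, hB]
    by_cases hij : i = j
    · subst hij
      obtain ⟨k, hk⟩ : ∃ k : Fin 4, i ≠ k := exists_ne i |>.imp fun _ h => h.symm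
      have := sum_pair hf hk (fun x _ => (if x = a then (1 : ZMod 2) else 0) * (if x = b then 1 else 0))
      rw [this]
      have h6 : (6 : ZMod 2) = 0 := by decide
      simp [h6]
    · have := sum_pair hf hij (fun x y => (if x = a then (1 : ZMod 2) else 0) * (if y = b then 1 else 0))
      rw [this]
      simp [hij]
  have hr := sylvester M.mulVecLin M.transpose.mulVecLin
  rw [← Matrix.mulVecLin_mul, hMM] at hr
  have hA4 : Module.finrank (ZMod 2) (LinearMap.range (A * B.transpose).mulVecLin) ≤ 4 := by
    have h1 := Matrix.rank_mul_le_left A B.transpose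
    have h2 := Matrix.rank_le_card_width A
    simp only [Fintype.card_fin] at h2
    exact h1.trans h2
  have hB4 : Module.finrank (ZMod 2) (LinearMap.range B.mulVecLin) ≤ 4 := by
    have h2 := Matrix.rank_le_card_width B
    simp only [Fintype.card_fin] at h2
    exact h2
  have n1 := LinearMap.finrank_range_add_finrank_ker M.mulVecLin
  have n2 := LinearMap.finrank_range_add_finrank_ker M.transpose.mulVecLin
  have ht : Module.finrank (ZMod 2) (LinearMap.range M.transpose.mulVecLin) =
     Module.finrank (ZMod 2) (LinearMap.range M.mulVecLin) := Matrix.rank_transpose M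
  simp only [Module.finrank_fintype_fun_eq_card, Fintype.card_prod, Fintype.card_fin, hcard] at n1 n2
  by_cases hle : LinearMap.ker M.mulVecLin ≤ LinearMap.range B.mulVecLin
  · exfalso
    have heq := Submodule.eq_of_le_of_finrank_le hle (by omega)
    have hmem : B.mulVecLin (Pi.single 0 1) ∈ LinearMap.ker M.mulVecLin := by
      rw [heq]; exact ⟨_, rfl⟩
    obtain ⟨p⟩ : Nonempty P := Fintype.card_pos_iff.mp (by omega)
    have := congrFun (LinearMap.mem_ker.mp hmem) p
    simp [Matrix.mulVec, dotProduct, hM, hB, Fintype.sum_prod_type] at this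
  · obtain ⟨c, hc, hcB⟩ := SetLike.not_le_iff_exists.mp hle
    refine ⟨fun i a => c (i, a), fun p => ?_, ?_⟩
    · have := congrFun (LinearMap.mem_ker.mp hc) p
      simpa [Matrix.mulVec, dotProduct, hM, Fintype.sum_prod_type] using this
    · rintro ⟨d, hd⟩
      apply hcB
      refine ⟨d, ?_⟩
      ext ⟨i, a⟩
      simp [Matrix.mulVec, dotProduct, hB, hd]

/-- a `0/1` valued weight on the lines, of even total weight at every point -/
def NRel {P : Type} (f : Fin 4 → P → Fin 6) (c : Fin 4 → Fin 6 → ℤ) : Prop :=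
  (∀ i a, c i a = 0 ∨ c i a = 1) ∧
    ∀ p, Even (c 0 (f 0 p) + c 1 (f 1 p) + c 2 (f 2 p) + c 3 (f 3 p))

/-- number of chosen lines in a class -/
def wt (c : Fin 4 → Fin 6 → ℤ) (i : Fin 4) : ℤ := ∑ a, c i a

section
set_option linter.unusedSectionVars false
set_option linter.unnecessarySeqFocus false
variable {P : Type} [Fintype P] {f : Fin 4 → P → Fin 6} {c : Fin 4 → Fin 6 → ℤ}

theorem sum_mul (hf : PairBij f) {i j : Fin 4} (hij : i ≠ j) :
    ∑ p, c i (f i p) * c j (f j p) = wt c i * wt c j := by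
  rw [sum_pair hf hij (fun a b => c i a * c j b), wt, wt, Finset.sum_mul_sum]

theorem sum_one (hf : PairBij f) (i : Fin 4) : ∑ p, c i (f i p) = 6 * wt c i := by
  obtain ⟨j, hj⟩ := exists_ne i
  rw [sum_pair hf hj.symm (fun a _ => c i a), wt, Finset.mul_sum]
  simp

theorem sum_line (hf : PairBij f) {i j : Fin 4} (hij : i ≠ j) (u : Fin 6) :
    ∑ p, (if f i p = u then 1 else 0) * c j (f j p) = wt c j := by
  rw [sum_pair hf hij (fun a b => (if a = u then 1 else 0) * c j b), wt]
  simp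

theorem sum_line_self (hf : PairBij f) (i : Fin 4) (u : Fin 6) :
    ∑ p, (if f i p = u then 1 else 0) * c i (f i p) = 6 * c i u := by
  obtain ⟨j, hj⟩ := exists_ne i
  rw [sum_pair hf hj.symm (fun a b => (if a = u then 1 else 0) * c i a)]
  simp

theorem ident (hf : PairBij f) (hc : NRel f c) {i j k l : Fin 4}
    (hij : i ≠ j) (hik : i ≠ k) (hil : i ≠ l)
    (hn : ∀ p, Even (c i (f i p) + c j (f j p) + c k (f k p) + c l (f l p))) :
    wt c i * (wt c j + wt c k + wt c l - 6) =
      2 * ∑ p, c i (f i p) * c j (f j p) * c k (f k p) * c l (f l p) ∧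
    Even (wt c j + wt c k + wt c l) := by
  constructor
  · rw [Finset.mul_sum]
    have : ∀ p, 2 * (c i (f i p) * c j (f j p) * c k (f k p) * c l (f l p)) =
        c i (f i p) * c j (f j p) + c i (f i p) * c k (f k p) + c i (f i p) * c l (f l p)
        - c i (f i p) := by
      intro p
      have h := hn p
      rcases hc.1 i (f i p) with h1 | h1 <;> rcases hc.1 j (f j p) with h2 | h2 <;>
      rcases hc.1 k (f k p) with h3 | h3 <;> rcases hc.1 l (f l p) with h4 | h4 <;>
      rw [h1, h2, h3, h4] at h ⊢ <;> revert h <;> decide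
    simp only [this]
    rw [Finset.sum_sub_distrib, Finset.sum_add_distrib, Finset.sum_add_distrib, sum_mul hf hij,
      sum_mul hf hik, sum_mul hf hil, sum_one hf]
    ring
  · have h : Even (∑ p, (if f i p = 0 then 1 else 0) *
        (c i (f i p) + c j (f j p) + c k (f k p) + c l (f l p))) :=
      Finset.even_sum _ (fun p _ => (hn p).mul_left _)
    simp only [mul_add, Finset.sum_add_distrib] at h
    rw [sum_line hf hij, sum_line hf hik, sum_line hf hil, sum_line_self hf] at h
    rw [Int.even_iff] at h ⊢
    omega

theorem wt_bounds (hc : NRel f c) (i : Fin 4) : 0 ≤ wt c i ∧ wt c i ≤ 6 := by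
  constructor
  · exact Finset.sum_nonneg fun a _ => by rcases hc.1 i a with h | h <;> rw [h] <;> norm_num
  · calc wt c i ≤ ∑ a : Fin 6, 1 :=
        Finset.sum_le_sum fun a _ => by rcases hc.1 i a with h | h <;> rw [h] <;> norm_num
      _ = 6 := by simp

/-- numerical consequences of a relation -/
def NNum (s0 s1 s2 s3 : ℤ) : Prop :=
  s0 * (s1 + s2 + s3 - 6) = s1 * (s0 + s2 + s3 - 6) ∧
  s0 * (s1 + s2 + s3 - 6) = s2 * (s0 + s1 + s3 - 6) ∧
  s0 * (s1 + s2 + s3 - 6) = s3 * (s0 + s1 + s2 - 6) ∧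
  0 ≤ s0 * (s1 + s2 + s3 - 6) ∧
  (s1 + s2 + s3) % 2 = 0 ∧ (s0 + s2 + s3) % 2 = 0 ∧ (s0 + s1 + s3) % 2 = 0 ∧
  (s0 + s1 + s2) % 2 = 0

instance (s0 s1 s2 s3 : ℤ) : Decidable (NNum s0 s1 s2 s3) := by unfold NNum; infer_instance

theorem rel_num (hf : PairBij f) (hc : NRel f c) : NNum (wt c 0) (wt c 1) (wt c 2) (wt c 3) := by
  have e0 := ident hf hc (i := 0) (j := 1) (k := 2) (l := 3) (by decide) (by decide) (by decide)
    hc.2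
  have e1 := ident hf hc (i := 1) (j := 0) (k := 2) (l := 3) (by decide) (by decide) (by decide)
    (fun p => by have := hc.2 p; rw [Int.even_iff] at *; omega)
  have e2 := ident hf hc (i := 2) (j := 0) (k := 1) (l := 3) (by decide) (by decide) (by decide)
    (fun p => by have := hc.2 p; rw [Int.even_iff] at *; omega)
  have e3 := ident hf hc (i := 3) (j := 0) (k := 1) (l := 2) (by decide) (by decide) (by decide)
    (fun p => by have := hc.2 p; rw [Int.even_iff] at *; omega)
  simp only [Int.even_iff] at e0 e1 e2 e3
  have t1 : ∀ p, c 1 (f 1 p) * c 0 (f 0 p) * c 2 (f 2 p) * c 3 (f 3 p) =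
    c 0 (f 0 p) * c 1 (f 1 p) * c 2 (f 2 p) * c 3 (f 3 p) := fun p => by ring
  have t2 : ∀ p, c 2 (f 2 p) * c 0 (f 0 p) * c 1 (f 1 p) * c 3 (f 3 p) =
    c 0 (f 0 p) * c 1 (f 1 p) * c 2 (f 2 p) * c 3 (f 3 p) := fun p => by ring
  have t3 : ∀ p, c 3 (f 3 p) * c 0 (f 0 p) * c 1 (f 1 p) * c 2 (f 2 p) =
    c 0 (f 0 p) * c 1 (f 1 p) * c 2 (f 2 p) * c 3 (f 3 p) := fun p => by ring
  rw [Finset.sum_congr rfl (fun p _ => t1 p)] at e1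
  rw [Finset.sum_congr rfl (fun p _ => t2 p)] at e2
  rw [Finset.sum_congr rfl (fun p _ => t3 p)] at e3
  refine ⟨e0.1.trans e1.1.symm, e0.1.trans e2.1.symm, e0.1.trans e3.1.symm, ?_, e0.2, e1.2, e2.2,
    e3.2⟩
  rw [e0.1]
  have : 0 ≤ ∑ p, c 0 (f 0 p) * c 1 (f 1 p) * c 2 (f 2 p) * c 3 (f 3 p) := by
    refine Finset.sum_nonneg fun p _ => ?_
    have h : ∀ i a, 0 ≤ c i a := fun i a => by rcases hc.1 i a with h | h <;> rw [h]; norm_num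
    have := h 0 (f 0 p)
    have := h 1 (f 1 p)
    have := h 2 (f 2 p)
    have := h 3 (f 3 p)
    positivity
  omega

/-- complement a class -/
def flipc (e : Fin 4 → Bool) (c : Fin 4 → Fin 6 → ℤ) (i : Fin 4) (a : Fin 6) : ℤ :=
  if e i then 1 - c i a else c i a

def flips (e : Bool) (s : ℤ) : ℤ := if e then 6 - s else s

theorem wt_flip (e : Fin 4 → Bool) (i : Fin 4) : wt (flipc e c) i = flips (e i) (wt c i) := by
  unfold wt flipc flips
  split_ifs <;> simp

theorem rel_flip (hc : NRel f c) (e : Fin 4 → Bool) (he : (e 0 ^^ e 1 ^^ e 2 ^^ e 3) = false) :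
    NRel f (flipc e c) := by
  constructor
  · intro i a
    unfold flipc
    rcases hc.1 i a with h | h <;> rw [h] <;> split_ifs <;> simp
  · intro p
    have h := hc.2 p
    unfold flipc
    rw [Int.even_iff] at *
    revert he
    cases e 0 <;> cases e 1 <;> cases e 2 <;> cases e 3 <;> simp <;> omega

theorem num_search : ∀ s0 s1 s2 s3 : Fin 7,
    (∀ e0 e1 e2 e3 : Bool, (e0 ^^ e1 ^^ e2 ^^ e3) = false →
      NNum (flips e0 s0.val) (flips e1 s1.val) (flips e2 s2.val) (flips e3 s3.val)) →
    ((s0 = 0 ∨ s0 = 6) ∧ (s1 = 0 ∨ s1 = 6) ∧ (s2 = 0 ∨ s2 = 6) ∧ (s3 = 0 ∨ s3 = 6)) ∨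
    ∃ e0 e1 e2 e3 : Bool, (e0 ^^ e1 ^^ e2 ^^ e3) = false ∧ flips e0 s0.val = 2 ∧
      flips e1 s1.val = 2 ∧ flips e2 s2.val = 2 ∧ flips e3 s3.val = 2 := by
  unfold flips
  decide +kernel

theorem wt_zero (hc : NRel f c) (i : Fin 4) (h : wt c i = 0) (a : Fin 6) : c i a = 0 := by
  unfold wt at h
  rw [Finset.sum_eq_zero_iff_of_nonneg
    (fun a _ => by rcases hc.1 i a with h | h <;> rw [h]; norm_num)] at h
  exact h a (Finset.mem_univ a)

theorem wt_six (hc : NRel f c) (i : Fin 4) (h : wt c i = 6) (a : Fin 6) : c i a = 1 := by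
  have h2 : ∑ a, (1 - c i a) = 0 := by
    unfold wt at h
    simp [h]
  rw [Finset.sum_eq_zero_iff_of_nonneg
    (fun a _ => by rcases hc.1 i a with h | h <;> rw [h] <;> norm_num)] at h2
  have := h2 a (Finset.mem_univ a)
  omega

theorem normalize_rel (hf : PairBij f) (hc : NRel f c)
    (hnc : ¬ ∃ d : Fin 4 → ℤ, ∀ i a, c i a = d i) :
    ∃ c', NRel f c' ∧ ∀ i, wt c' i = 2 := by
  have hb : ∀ i, ∃ s : Fin 7, wt c i = (s.val : ℤ) := fun i => by
    have := wt_bounds hc i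
    exact ⟨⟨(wt c i).toNat, by omega⟩, by simp; omega⟩
  choose s hs using hb
  rcases num_search (s 0) (s 1) (s 2) (s 3) (fun e0 e1 e2 e3 he => by
    have := rel_num hf (rel_flip hc ![e0, e1, e2, e3] he)
    simp only [wt_flip, hs] at this
    exact this) with h | ⟨e0, e1, e2, e3, he, h0, h1, h2, h3⟩
  · exfalso
    apply hnc
    have h' : ∀ i, s i = 0 ∨ s i = 6 := by
      intro i; fin_cases i
      exacts [h.1, h.2.1, h.2.2.1, h.2.2.2]
    refine ⟨fun i => c i 0, fun i a => ?_⟩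
    rcases h' i with h | h
    · have hw : wt c i = 0 := by rw [hs, h]; rfl
      exact (wt_zero hc i hw a).trans (wt_zero hc i hw 0).symm
    · have hw : wt c i = 6 := by rw [hs, h]; rfl
      exact (wt_six hc i hw a).trans (wt_six hc i hw 0).symm
  · refine ⟨_, rel_flip hc ![e0, e1, e2, e3] he, fun i => ?_⟩
    rw [wt_flip, hs]
    fin_cases i
    exacts [h0, h1, h2, h3]

theorem prod_zero (hf : PairBij f) (hc : NRel f c) (hw : ∀ i, wt c i = 2) (p : P) :
    c 0 (f 0 p) + c 1 (f 1 p) + c 2 (f 2 p) + c 3 (f 3 p) = 0 ∨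
    c 0 (f 0 p) + c 1 (f 1 p) + c 2 (f 2 p) + c 3 (f 3 p) = 2 := by
  have e0 := (ident hf hc (i := 0) (j := 1) (k := 2) (l := 3) (by decide) (by decide) (by decide)
    hc.2).1
  simp only [hw] at e0
  have h : ∀ i a, 0 ≤ c i a := fun i a => by rcases hc.1 i a with h | h <;> rw [h]; norm_num
  have e1 : ∑ p, c 0 (f 0 p) * c 1 (f 1 p) * c 2 (f 2 p) * c 3 (f 3 p) = 0 := by omega
  rw [Finset.sum_eq_zero_iff_of_nonneg (fun p _ => by
    have := h 0 (f 0 p)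
    have := h 1 (f 1 p)
    have := h 2 (f 2 p)
    have := h 3 (f 3 p)
    positivity)] at e1
  have e2 := e1 p (Finset.mem_univ p)
  have hp := hc.2 p
  rw [Int.even_iff] at hp
  rcases hc.1 0 (f 0 p) with h1 | h1 <;> rcases hc.1 1 (f 1 p) with h2 | h2 <;>
      rcases hc.1 2 (f 2 p) with h3 | h3 <;> rcases hc.1 3 (f 3 p) with h4 | h4 <;>
      rw [h1, h2, h3, h4] at e2 hp ⊢ <;> revert e2 hp <;> decide

theorem unique_type (hf : PairBij f) (h01 : ∀ i a, c i a = 0 ∨ c i a = 1) (hw : ∀ i, wt c i = 2)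
    {i j k l : Fin 4} (hij : i ≠ j) (hik : i ≠ k) (hil : i ≠ l)
    (hn : ∀ p, c i (f i p) + c j (f j p) + c k (f k p) + c l (f l p) = 0 ∨
      c i (f i p) + c j (f j p) + c k (f k p) + c l (f l p) = 2) (u : Fin 6) (hu : c i u = 0) :
    ∃! p, f i p = u ∧ c k (f k p) = 1 ∧ c l (f l p) = 1 := by
  classical
  have key : ∀ p, 2 * (if f i p = u ∧ c k (f k p) = 1 ∧ c l (f l p) = 1 then (1 : ℤ) else 0) =
      (if f i p = u then 1 else 0) * c k (f k p) + (if f i p = u then 1 else 0) * c l (f l p)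
      - (if f i p = u then 1 else 0) * c j (f j p) := by
    intro p
    by_cases hp : f i p = u
    · have h := hn p
      rw [hp, hu] at h
      rcases h01 j (f j p) with h2 | h2 <;>
      rcases h01 k (f k p) with h3 | h3 <;> rcases h01 l (f l p) with h4 | h4 <;>
      rw [h2, h3, h4] at h ⊢ <;> simp [hp] at h ⊢
    · simp [hp]
  have hs : 2 * ∑ p, (if f i p = u ∧ c k (f k p) = 1 ∧ c l (f l p) = 1 then (1 : ℤ) else 0) = 2 := by
    rw [Finset.mul_sum, Finset.sum_congr rfl (fun p _ => key p), Finset.sum_sub_distrib,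
      Finset.sum_add_distrib, sum_line hf hij, sum_line hf hik, sum_line hf hil, hw, hw, hw]
    norm_num
  have hs' : (Finset.univ.filter (fun p => f i p = u ∧ c k (f k p) = 1 ∧ c l (f l p) = 1)).card = 1 := by
    rw [Finset.sum_boole] at hs
    omega
  obtain ⟨p, hp⟩ := Finset.card_eq_one.mp hs'
  have hm : ∀ q, (f i q = u ∧ c k (f k q) = 1 ∧ c l (f l q) = 1) ↔ q = p := fun q => by
    have := Finset.ext_iff.mp hp q
    simpa using this
  exact ⟨p, (hm p).2 rfl, fun q hq => (hm q).1 hq⟩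

end

theorem no_configuration {P : Type} [Fintype P] {f : Fin 4 → P → Fin 6} {c : Fin 4 → Fin 6 → ℤ}
    (hf : PairBij f) (h01 : ∀ i a, c i a = 0 ∨ c i a = 1) (hw : ∀ i, wt c i = 2)
    (hn : ∀ p, c 0 (f 0 p) + c 1 (f 1 p) + c 2 (f 2 p) + c 3 (f 3 p) = 0 ∨
      c 0 (f 0 p) + c 1 (f 1 p) + c 2 (f 2 p) + c 3 (f 3 p) = 2) : False := by
  classical
  -- two points with two common coordinates are equal
  have inj : ∀ i j : Fin 4, i ≠ j → ∀ p q, f i p = f i q → f j p = f j q → p = q :=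
    fun i j hij p q h1 h2 => (hf i j hij).1 (Prod.ext h1 h2)
  have card1 : ∀ i, (Finset.univ.filter (fun a => c i a = 1)).card = 2 := by
    intro i
    have h : wt c i = ∑ a, (if c i a = 1 then (1 : ℤ) else 0) :=
      Finset.sum_congr rfl fun a _ => by rcases h01 i a with h | h <;> rw [h] <;> norm_num
    rw [hw, Finset.sum_boole] at h
    exact_mod_cast h.symm
  have card0 : ∀ i, Fintype.card {a // c i a = 0} = 4 := by
    intro i
    rw [Fintype.card_subtype]
    have h := Finset.card_filter_add_card_filter_not (s := (Finset.univ : Finset (Fin 6)))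
      (fun a => c i a = 1)
    rw [card1] at h
    have h2 : (Finset.univ.filter (fun a => c i a = 0)) =
        (Finset.univ.filter (fun a => ¬ c i a = 1)) := by
      ext a
      rcases h01 i a with h | h <;> simp [h]
    rw [h2]
    simp at h
    omega
  have U01 := fun u => unique_type hf h01 hw (i := 0) (j := 1) (k := 2) (l := 3)
    (by decide) (by decide) (by decide) (fun p => by have := hn p; omega) u
  have U10 := fun u => unique_type hf h01 hw (i := 1) (j := 0) (k := 2) (l := 3)
    (by decide) (by decide) (by decide) (fun p => by have := hn p; omega) u
  have U02 := fun u => unique_type hf h01 hw (i := 0) (j := 2) (k := 1) (l := 3)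
    (by decide) (by decide) (by decide) (fun p => by have := hn p; omega) u
  have U20 := fun u => unique_type hf h01 hw (i := 2) (j := 0) (k := 1) (l := 3)
    (by decide) (by decide) (by decide) (fun p => by have := hn p; omega) u
  have U03 := fun u => unique_type hf h01 hw (i := 0) (j := 3) (k := 1) (l := 2)
    (by decide) (by decide) (by decide) (fun p => by have := hn p; omega) u
  have U30 := fun u => unique_type hf h01 hw (i := 3) (j := 0) (k := 1) (l := 2)
    (by decide) (by decide) (by decide) (fun p => by have := hn p; omega) u
  let g : Fin 4 ≃ {a // c 0 a = 0} := (Fintype.equivFinOfCardEq (card0 0)).symm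
  choose p1 hp1 _ using fun t => U01 (g t).1 (g t).2
  choose p2 hp2 _ using fun t => U02 (g t).1 (g t).2
  choose p3 hp3 _ using fun t => U03 (g t).1 (g t).2
  have g0 : ∀ t, c 0 (g t).1 = 0 := fun t => (g t).2
  have z1 : ∀ t, c 1 (f 1 (p1 t)) = 0 := fun t => by
    have h := hn (p1 t)
    rw [(hp1 t).1, (hp1 t).2.1, (hp1 t).2.2, g0] at h
    rcases h01 1 (f 1 (p1 t)) with h' | h' <;> omega
  have z2 : ∀ t, c 2 (f 2 (p2 t)) = 0 := fun t => by
    have h := hn (p2 t)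
    rw [(hp2 t).1, (hp2 t).2.1, (hp2 t).2.2, g0] at h
    rcases h01 2 (f 2 (p2 t)) with h' | h' <;> omega
  have z3 : ∀ t, c 3 (f 3 (p3 t)) = 0 := fun t => by
    have h := hn (p3 t)
    rw [(hp3 t).1, (hp3 t).2.1, (hp3 t).2.2, g0] at h
    rcases h01 3 (f 3 (p3 t)) with h' | h' <;> omega
  have ginj : ∀ s t, (g s).1 = (g t).1 → s = t := fun s t h => g.injective (Subtype.ext h)
  have gsurj : ∀ a, c 0 a = 0 → ∃ t, (g t).1 = a := fun a ha => by
    obtain ⟨t, ht⟩ := g.surjective ⟨a, ha⟩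
    exact ⟨t, by rw [ht]⟩
  have i1 : ∀ s t, f 1 (p1 s) = f 1 (p1 t) → s = t := fun s t h => by
    have := (U10 _ (z1 t)).unique (y₁ := p1 s) (y₂ := p1 t) ⟨h, (hp1 s).2⟩ ⟨rfl, (hp1 t).2⟩
    apply ginj
    rw [← (hp1 s).1, ← (hp1 t).1, this]
  have i2 : ∀ s t, f 2 (p2 s) = f 2 (p2 t) → s = t := fun s t h => by
    have := (U20 _ (z2 t)).unique (y₁ := p2 s) (y₂ := p2 t) ⟨h, (hp2 s).2⟩ ⟨rfl, (hp2 t).2⟩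
    apply ginj
    rw [← (hp2 s).1, ← (hp2 t).1, this]
  have i3 : ∀ s t, f 3 (p3 s) = f 3 (p3 t) → s = t := fun s t h => by
    have := (U30 _ (z3 t)).unique (y₁ := p3 s) (y₂ := p3 t) ⟨h, (hp3 s).2⟩ ⟨rfl, (hp3 t).2⟩
    apply ginj
    rw [← (hp3 s).1, ← (hp3 t).1, this]
  have surj : ∀ (i : Fin 4) (h : Fin 4 → Fin 6) (_ : ∀ t, c i (h t) = 0)
      (_ : ∀ s t, h s = h t → s = t) (a : Fin 6), c i a = 0 → ∃ t, h t = a := by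
    intro i h hz hi a ha
    have hb : Function.Bijective (fun t => (⟨h t, hz t⟩ : {a // c i a = 0})) := by
      rw [Fintype.bijective_iff_injective_and_card]
      refine ⟨fun s t hst => hi s t (congrArg Subtype.val hst), ?_⟩
      rw [card0, Fintype.card_fin]
    obtain ⟨t, ht⟩ := hb.2 ⟨a, ha⟩
    exact ⟨t, congrArg Subtype.val ht⟩
  have s2 := surj 2 (fun t => f 2 (p2 t)) z2 i2
  have s3 := surj 3 (fun t => f 3 (p3 t)) z3 i3
  choose q hq using fun x y => (hf 0 1 (by decide)).2 ((g x).1, f 1 (p1 y))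
  have q0 : ∀ x y, f 0 (q x y) = (g x).1 := fun x y => congrArg Prod.fst (hq x y)
  have q1 : ∀ x y, f 1 (q x y) = f 1 (p1 y) := fun x y => congrArg Prod.snd (hq x y)
  -- the off-diagonal points have weight zero
  have qz : ∀ x y, x ≠ y → c 2 (f 2 (q x y)) = 0 ∧ c 3 (f 3 (q x y)) = 0 := by
    intro x y hxy
    have h := hn (q x y)
    rw [q0, q1, g0, z1] at h
    rcases h01 2 (f 2 (q x y)) with h2 | h2 <;> rcases h01 3 (f 3 (q x y)) with h3 | h3
    · exact ⟨h2, h3⟩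
    · omega
    · omega
    · exfalso
      have := (U01 _ (g0 x)).unique (y₁ := q x y) (y₂ := p1 x) ⟨q0 x y, h2, h3⟩ (hp1 x)
      apply hxy
      apply i1
      rw [← this, q1]
  have ex : ∀ x y, ∃ s t, x ≠ y → f 2 (q x y) = f 2 (p2 s) ∧ f 3 (q x y) = f 3 (p3 t) := by
    intro x y
    by_cases hxy : x = y
    · exact ⟨0, 0, fun h => absurd hxy h⟩
    · obtain ⟨s, hs⟩ := s2 _ (qz x y hxy).1
      obtain ⟨t, ht⟩ := s3 _ (qz x y hxy).2
      exact ⟨s, t, fun _ => ⟨hs.symm, ht.symm⟩⟩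
  choose σ τ hst using ex
  have qinj : ∀ x y x' y', q x y = q x' y' → x = x' ∧ y = y' := fun x y x' y' h =>
    ⟨ginj _ _ (by rw [← q0 x y, ← q0 x' y', h]), i1 _ _ (by rw [← q1 x y, ← q1 x' y', h])⟩
  refine fin_search' σ τ ?_ ?_ ?_ ?_ ?_ ?_ ?_ ?_
  · intro x y hxy h
    have e := (hst x y hxy).1
    rw [h] at e
    have := inj 0 2 (by decide) (q x y) (p2 x) (by rw [q0, (hp2 x).1]) e
    have h1 := (hp2 x).2.1
    rw [← this, q1, z1] at h1
    omega
  · intro x y hxy h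
    have e := (hst x y hxy).2
    rw [h] at e
    have := inj 0 3 (by decide) (q x y) (p3 x) (by rw [q0, (hp3 x).1]) e
    have h1 := (hp3 x).2.1
    rw [← this, q1, z1] at h1
    omega
  · intro x y z hxy hxz hyz h
    refine hyz (qinj _ _ _ _ (inj 0 2 (by decide) (q x y) (q x z) (by rw [q0, q0]) ?_)).2
    rw [(hst x y hxy).1, (hst x z hxz).1, h]
  · intro x y z hxy hxz hyz h
    refine hyz (qinj _ _ _ _ (inj 0 3 (by decide) (q x y) (q x z) (by rw [q0, q0]) ?_)).2
    rw [(hst x y hxy).2, (hst x z hxz).2, h]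
  · intro x y z hxz hyz hxy h
    refine hxy (qinj _ _ _ _ (inj 1 2 (by decide) (q x z) (q y z) (by rw [q1, q1]) ?_)).1
    rw [(hst x z hxz).1, (hst y z hyz).1, h]
  · intro x y z hxz hyz hxy h
    refine hxy (qinj _ _ _ _ (inj 1 3 (by decide) (q x z) (q y z) (by rw [q1, q1]) ?_)).1
    rw [(hst x z hxz).2, (hst y z hyz).2, h]
  · intro x y x' y' hxy hxy' hxx h
    have e1 := congrArg Prod.fst h
    have e2 := congrArg Prod.snd h
    simp only at e1 e2
    refine hxx (qinj _ _ _ _ (inj 2 3 (by decide) (q x y) (q x' y') ?_ ?_)).1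
    · rw [(hst x y hxy).1, (hst x' y' hxy').1, e1]
    · rw [(hst x y hxy).2, (hst x' y' hxy').2, e2]
  · intro y
    obtain ⟨r, hr⟩ := (hf 1 2 (by decide)).2 (f 1 (p1 y), f 2 (p2 y))
    have r1 : f 1 r = f 1 (p1 y) := congrArg Prod.fst hr
    have r2 : f 2 r = f 2 (p2 y) := congrArg Prod.snd hr
    have h := hn r
    rw [r1, r2, z1, z2] at h
    have hp12 : p1 y ≠ p2 y := fun e => by
      have h1 := z1 y
      rw [e, (hp2 y).2.1] at h1
      omega
    have hp1r : p1 y ≠ r := fun e => by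
      have h1 := (hp1 y).2.1
      rw [e, r2, z2] at h1
      omega
    have hp2r : p2 y ≠ r := fun e => by
      have h1 := (hp2 y).2.1
      rw [e, r1, z1] at h1
      omega
    have hr0 : c 0 (f 0 r) = 0 := by
      rcases h01 0 (f 0 r) with h0 | h0
      · exact h0
      · exfalso
        have h3 : c 3 (f 3 r) = 1 := by
          rcases h01 3 (f 3 r) with h3 | h3 <;> omega
        have hlt : 2 < (Finset.univ.filter (fun a => c 3 a = 1)).card := by
          rw [Finset.two_lt_card]
          refine ⟨f 3 (p1 y), ?_, f 3 (p2 y), ?_, f 3 r, ?_, ?_, ?_, ?_⟩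
          · simpa using (hp1 y).2.2
          · simpa using (hp2 y).2.2
          · simpa using h3
          · exact fun e => hp12 (inj 0 3 (by decide) _ _ (by rw [(hp1 y).1, (hp2 y).1]) e)
          · exact fun e => hp1r (inj 1 3 (by decide) _ _ r1.symm e)
          · exact fun e => hp2r (inj 2 3 (by decide) _ _ r2.symm e)
        rw [card1] at hlt
        omega
    obtain ⟨x, hx⟩ := gsurj _ hr0
    have hrq : r = q x y := inj 0 1 (by decide) _ _ (by rw [q0, hx]) (by rw [q1, r1])
    have hxy : x ≠ y := by
      rintro rfl
      exact hp1r (inj 0 1 (by decide) _ _ (by rw [(hp1 x).1, hx]) r1.symm)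
    refine ⟨x, hxy, i2 _ _ ?_⟩
    rw [← (hst x y hxy).1, ← hrq, r2]

theorem no_pairBij {P : Type} [Fintype P] (f : Fin 4 → P → Fin 6) (hf : PairBij f) : False := by
  obtain ⟨c, hc, hnc⟩ := exists_relation f hf
  have hrel : NRel f (fun i a => ((c i a).val : ℤ)) := by
    constructor
    · intro i a
      have := ZMod.val_lt (c i a)
      change ((c i a).val : ℤ) = 0 ∨ ((c i a).val : ℤ) = 1
      omega
    · intro p
      have h := hc p
      rw [Fin.sum_univ_four] at h
      rw [← ZMod.intCast_eq_zero_iff_even]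
      push_cast
      simpa using h
  obtain ⟨c', hc', hw⟩ := normalize_rel hf hrel (by
    rintro ⟨d, hd⟩
    refine hnc ⟨fun i => c i 0, fun i a => ?_⟩
    have h := (hd i a).trans (hd i 0).symm
    exact ZMod.val_injective 2 (by exact_mod_cast h))
  exact no_configuration hf hc'.1 hw (prod_zero hf hc' hw)

end OfficerProof

/-- **Euler's 36 officers conjecture, net form.** There is no `(6,4)` net. -/
theorem no_net64 :
    ¬ ∃ (P : Type) (_ : Fintype P) (_ : DecidableEq P), Nonempty (Net64 P) := by
  rintro ⟨P, _, _, ⟨N⟩⟩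
  choose f hf hu using N.partition
  refine OfficerProof.no_pairBij f ?_
  intro i j hij
  constructor
  · intro p q h
    have h1 : f i p = f i q := congrArg Prod.fst h
    have h2 : f j p = f j q := congrArg Prod.snd h
    refine Finset.card_le_one.mp (N.meet i j (f i p) (f j p) hij).le p ?_ q ?_
    · exact Finset.mem_inter.mpr ⟨hf i p, hf j p⟩
    · exact Finset.mem_inter.mpr ⟨h1 ▸ hf i q, h2 ▸ hf j q⟩
  · rintro ⟨a, b⟩
    obtain ⟨p, hp⟩ := Finset.card_eq_one.mp (N.meet i j a b hij)
    have hm : p ∈ N.line i a ∩ N.line j b := by rw [hp]; exact Finset.mem_singleton_self p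
    rw [Finset.mem_inter] at hm
    exact ⟨p, Prod.ext (hu i p a hm.1).symm (hu j p b hm.2).symm⟩
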